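/- Let p be a prime, K a field of characteristic p, and n ≥ 1. For every a ∈ W_n(K) and every b ∈ K^×, the element (F(a) − a)·[b⁻¹]·d([b]) of Ω¹(W_n(K)) belongs to M_n. (In the notation of the paper: ℘(a)·dlog[b] ∈ M_n for all a ∈ W_n(K), b ∈ K^×, where ℘ = F − id and [b⁻¹] = [b]⁻¹.) -/

import Mathlib

noncomputable section

namespace TruncatedWittVector

variable {p n : ℕ} [hp : Fact p.Prime] {R : Type*} [CommRing R]

/-- Verschiebung on truncated Witt vectors: `(x₀,…,x_{n-1}) ↦ (0,x₀,…,x_{n-2})`. -/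
def vers (x : TruncatedWittVector p n R) : TruncatedWittVector p n R :=
  WittVector.truncate n (WittVector.verschiebung x.out)

/-- Frobenius on truncated Witt vectors (in characteristic `p` it raises each
coefficient to the `p`-th power). -/
def frob (x : TruncatedWittVector p n R) : TruncatedWittVector p n R :=
  WittVector.truncate n (WittVector.frobenius x.out)

/-- Teichmüller representative `[a] = (a,0,…,0)` in truncated Witt vectors. -/
def teich (a : R) : TruncatedWittVector p n R :=
  WittVector.truncate n (WittVector.teichmuller p a)

end TruncatedWittVector

namespace TruncatedWittVector

section CharP

variable {p n : ℕ} [hp : Fact p.Prime] {R : Type*} [CommRing R]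

theorem vers_truncate (z : WittVector p R) :
    vers (WittVector.truncate n z) = WittVector.truncate n (WittVector.verschiebung z) := by
  ext i
  rw [vers, WittVector.coeff_truncate, WittVector.coeff_truncate]
  rcases h : (i : ℕ) with _ | m
  · simp
  · have hm : m < n := by omega
    rw [WittVector.verschiebung_coeff_succ, WittVector.verschiebung_coeff_succ]
    have := coeff_out (WittVector.truncate n z) ⟨m, hm⟩
    simpa [WittVector.coeff_truncate] using this

theorem frob_truncate [CharP R p] (z : WittVector p R) :
    frob (WittVector.truncate n z) = WittVector.truncate n (WittVector.frobenius z) := by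
  ext i
  rw [frob, WittVector.coeff_truncate, WittVector.coeff_truncate,
    WittVector.coeff_frobenius_charP, WittVector.coeff_frobenius_charP, coeff_out,
    WittVector.coeff_truncate]

end CharP

end TruncatedWittVector

theorem WittVector.frobenius_teichmuller
    {p : ℕ} [Fact p.Prime] {R : Type*} [CommRing R] [CharP R p] (c : R) :
    frobenius (teichmuller p c) = teichmuller p c ^ p := by
  rw [← map_pow]
  ext i
  rw [coeff_frobenius_charP]
  cases i with
  | zero => rw [teichmuller_coeff_zero, teichmuller_coeff_zero]
  | succ i =>
    rw [teichmuller_coeff_pos p _ _ i.succ_pos, teichmuller_coeff_pos p _ _ i.succ_pos,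
      zero_pow (Fact.out : p.Prime).ne_zero]

theorem WittVector.exists_eq_teichmuller_add_verschiebung
    {p : ℕ} [Fact p.Prime] {R : Type*} [CommRing R] (z : WittVector p R) :
    ∃ x : WittVector p R, z = teichmuller p (z.coeff 0) + verschiebung x := by
  have h : ∀ i < 0 + 1, (z - teichmuller p (z.coeff 0)).coeff i = 0 := by
    intro i hi
    obtain rfl : i = 0 := by omega
    change constantCoeff (z - teichmuller p (z.coeff 0)) = 0
    rw [map_sub, constantCoeff_apply, constantCoeff_apply, teichmuller_coeff_zero, sub_self]
  refine ⟨(z - teichmuller p (z.coeff 0)).shift 1, ?_⟩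
  rw [show (1 : ℕ) = Nat.succ 0 from rfl, verschiebung_shift _ 0 h,
    show (z - teichmuller p (z.coeff 0)).shift 0 = z - teichmuller p (z.coeff 0) from
      ext fun i => by simp [shift_coeff]]
  ring

/-- If `b * b' = 1`, then `(p * x - v) • dlog b` is the difference of
`b' ^ p • d(x * b ^ p) - b' • d(v * b)` and `d x - d v`. -/
theorem Derivation.smul_dlog_eq {A M : Type*} [CommRing A] [AddCommGroup M] [Module A M]
    (d : Derivation ℤ A M) {b b' : A} (h : b * b' = 1) (x v : A) {p : ℕ} (hp : p ≠ 0) :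
    ((x * p - v) * b') • d b =
      (b' ^ p • d (x * b ^ p) - b' • d (v * b)) - (d x - d v) := by
  obtain ⟨m, rfl⟩ := Nat.exists_eq_succ_of_ne_zero hp
  have hpow (k : ℕ) : b' ^ k * b ^ k = 1 := by rw [← mul_pow, mul_comm, h, one_pow]
  have h₁ : b' ^ (m + 1) • d (x * b ^ (m + 1)) =
      (x * ((m + 1 : ℕ) : A) * b') • d b + d x := by
    rw [d.leibniz, d.leibniz_pow, Nat.add_sub_cancel, smul_add, ← Nat.cast_smul_eq_nsmul A]
    simp only [smul_smul]
    rw [hpow, one_smul]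
    congr 2
    linear_combination (x * ((m + 1 : ℕ) : A) * b') * hpow m
  have h₂ : b' • d (v * b) = (v * b') • d b + d v := by
    rw [d.leibniz, smul_add, smul_smul, smul_smul, mul_comm b' b, h, one_smul, mul_comm b' v]
  rw [Nat.succ_eq_add_one, h₁, h₂, sub_mul, sub_smul]
  abel

/-- For every `a ∈ W_n(K)` and `b ∈ K^×`, the element
`℘(a)·dlog[b] = (F(a) − a)·[b⁻¹]·d([b])` of `Ω¹(W_n(K))` belongs to `M_n`, the additive
subgroup generated by the elements `F(x)·d(y) − x·d(V(y))` for `x, y ∈ W_n(K)` together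
with the elements `([c]^p − [c])·[e⁻¹]·d([e])` for `c ∈ K`, `e ∈ K^×`. -/
theorem wp_a_dlog_teich_mem_M
    (p : ℕ) [Fact p.Prime] (K : Type*) [Field K] [CharP K p] (n : ℕ) (hn : 1 ≤ n)
    (a : TruncatedWittVector p n K) (b : K) (hb : b ≠ 0) :
    ((TruncatedWittVector.frob a - a) * TruncatedWittVector.teich b⁻¹) •
        KaehlerDifferential.D ℤ (TruncatedWittVector p n K) (TruncatedWittVector.teich b) ∈
      AddSubgroup.closure
        ({ω : Ω[TruncatedWittVector p n K⁄ℤ] |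
            ∃ x y : TruncatedWittVector p n K,
              ω = TruncatedWittVector.frob x • KaehlerDifferential.D ℤ _ y -
                x • KaehlerDifferential.D ℤ _ (TruncatedWittVector.vers y)} ∪
          {ω : Ω[TruncatedWittVector p n K⁄ℤ] |
            ∃ c e : K, e ≠ 0 ∧
              ω = ((TruncatedWittVector.teich c ^ p - TruncatedWittVector.teich c) *
                    TruncatedWittVector.teich e⁻¹ : TruncatedWittVector p n K) •
                  KaehlerDifferential.D ℤ (TruncatedWittVector p n K)
                    (TruncatedWittVector.teich e)}) := by
  obtain ⟨z, rfl⟩ := WittVector.truncate_surjective p n K a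
  obtain ⟨x, hx⟩ := WittVector.exists_eq_teichmuller_add_verschiebung z
  set T := WittVector.truncate (p := p) n (R := K)
  have hbb : T (WittVector.teichmuller p b) * T (WittVector.teichmuller p b⁻¹) = 1 := by
    rw [← map_mul, ← map_mul, mul_inv_cancel₀ hb, map_one, map_one]
  have hsplit : TruncatedWittVector.frob (T z) - T z =
      (TruncatedWittVector.teich (z.coeff 0) ^ p - TruncatedWittVector.teich (z.coeff 0)) +
        (T x * (p : TruncatedWittVector p n K) - T (WittVector.verschiebung x)) := by
    rw [TruncatedWittVector.frob_truncate]
    conv_lhs => rw [hx]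
    rw [map_add, WittVector.frobenius_teichmuller, WittVector.frobenius_verschiebung]
    simp only [map_add, map_mul, map_pow, map_natCast, TruncatedWittVector.teich, T]
    ring
  rw [hsplit, add_mul, add_smul]
  refine add_mem (AddSubgroup.subset_closure (Or.inr ⟨_, b, hb, rfl⟩)) ?_
  have hgen := (KaehlerDifferential.D ℤ (TruncatedWittVector p n K)).smul_dlog_eq hbb (T x)
    (T (WittVector.verschiebung x)) (Fact.out : p.Prime).ne_zero
  refine hgen ▸ sub_mem (AddSubgroup.subset_closure (Or.inl
    ⟨T (WittVector.teichmuller p b⁻¹), T (x * WittVector.teichmuller p b ^ p), ?_⟩))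
    (AddSubgroup.subset_closure (Or.inl ⟨T 1, T x, ?_⟩))
  · rw [TruncatedWittVector.frob_truncate, TruncatedWittVector.vers_truncate, WittVector.frobenius_teichmuller, ← WittVector.frobenius_teichmuller b,
      WittVector.verschiebung_mul_frobenius, WittVector.frobenius_teichmuller b]
    simp only [map_mul, map_pow, T]
  · rw [TruncatedWittVector.frob_truncate, TruncatedWittVector.vers_truncate]
    simp only [map_one, one_smul, T]
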